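/- Let G ≤ GL_n(F) be a finite reflection group and χ a linear character. If ω₁,...,ωₙ are χ-invariant 1-forms with ω₁∧...∧ωₙ = c·Q(Ã_χ)·Q_χ^{n−1}·Q_{χ·det}·vol for some c ∈ F^×, then the χ-invariant 1-forms (Ω¹)^G_χ form a free F[V]^G-module with basis ω₁,...,ωₙ. -/

import Mathlib

open MvPolynomial

abbrev GLn (F : Type*) [Field F] (n : ℕ) := (Fin n → F) ≃ₗ[F] (Fin n → F)

variable {F : Type*} [Field F] {n : ℕ}

/-- Matrix of the contragredient action of `g` on the coordinate functions:
`g · z_i = ∑ j (actMat g i j) z_j`. -/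
noncomputable def actMat (g : GLn F n) : Matrix (Fin n) (Fin n) F :=
  Matrix.of fun i j => g.symm (Pi.single j 1) i

/-- Action of `g ∈ GL(V)` on polynomials `F[V]` (contragredient action). -/
noncomputable def polyAct (g : GLn F n) : MvPolynomial (Fin n) F →ₐ[F] MvPolynomial (Fin n) F :=
  aeval fun i => ∑ j, C (actMat g i j) * X j

/-- The degree-one polynomial corresponding to a linear form on `V`. -/
noncomputable def linToPoly (z : (Fin n → F) →ₗ[F] F) : MvPolynomial (Fin n) F :=
  ∑ j, C (z (Pi.single j 1)) * X j

/-- The invariant ring `F[V]^G` as a subalgebra of `F[V]`. -/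
noncomputable def invSub (G : Subgroup (GLn F n)) : Subalgebra F (MvPolynomial (Fin n) F) where
  carrier := {f | ∀ g ∈ G, polyAct g f = f}
  add_mem' := fun {a b} ha hb g hg => by rw [map_add, ha g hg, hb g hg]
  mul_mem' := fun {a b} ha hb g hg => by rw [map_mul, ha g hg, hb g hg]
  algebraMap_mem' := fun r g hg => (polyAct g).commutes r

/-- Action of `g` on a differential 1-form `ω = ∑ i (w i) dz_i`; the result is the
coefficient vector of `g · ω`. -/
noncomputable def oneFormAct (g : GLn F n) (w : Fin n → MvPolynomial (Fin n) F) :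
    Fin n → MvPolynomial (Fin n) F :=
  fun j => ∑ i, polyAct g (w i) * C (actMat g i j)

/-- The coefficient of `dz_J` in `g · dz_I` (a minor determinant of `actMat g`). -/
noncomputable def minorDet (g : GLn F n) (I J : Finset (Fin n)) : F :=
  if h : J.card = I.card then
    Matrix.det (Matrix.of fun a b : Fin I.card =>
      actMat g (I.orderIsoOfFin rfl a) (J.orderIsoOfFin h b))
  else 0

/-- Action of `g` on a differential form `μ = ∑_I u_I dz_I`, given by its coefficient
function `u : Finset (Fin n) → F[V]`. -/
noncomputable def formAct (g : GLn F n) (u : Finset (Fin n) → MvPolynomial (Fin n) F) :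
    Finset (Fin n) → MvPolynomial (Fin n) F :=
  fun J => ∑ I : Finset (Fin n), polyAct g (u I) * C (minorDet g I J)

/-- The sign arising when wedging `dz_I ∧ dz_J` into `dz_(I ∪ J)` for disjoint `I`, `J`. -/
def wsign (I J : Finset (Fin n)) : ℤ :=
  (-1) ^ ((I ×ˢ J).filter fun p => p.2 < p.1).card

/-- Wedge product of differential forms in terms of coefficient functions. -/
noncomputable def wedgeF (u v : Finset (Fin n) → MvPolynomial (Fin n) F) :
    Finset (Fin n) → MvPolynomial (Fin n) F :=
  fun K => ∑ I ∈ K.powerset, wsign I (K \ I) • (u I * v (K \ I))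

/-- The constant 0-form `1`. -/
noncomputable def unitForm : Finset (Fin n) → MvPolynomial (Fin n) F :=
  fun S => if S = ∅ then 1 else 0

/-- Iterated wedge product of a list of forms. -/
noncomputable def iterWedge (L : List (Finset (Fin n) → MvPolynomial (Fin n) F)) :
    Finset (Fin n) → MvPolynomial (Fin n) F :=
  L.foldr wedgeF unitForm

/-- A 1-form, viewed as a differential form via its coefficient function. -/
noncomputable def oneToForm (w : Fin n → MvPolynomial (Fin n) F) :
    Finset (Fin n) → MvPolynomial (Fin n) F :=
  fun S => if h : S.card = 1 then w (S.min' (Finset.card_pos.mp (by omega))) else 0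

/-- The fixed space of `g` in `V`. -/
noncomputable def fixedSpace (g : GLn F n) : Submodule F (Fin n → F) :=
  LinearMap.ker (g.toLinearMap - LinearMap.id)

/-- A reflection: an element of finite order whose fixed space is a hyperplane. -/
def IsReflection (g : GLn F n) : Prop :=
  IsOfFinOrder g ∧ Module.finrank F (fixedSpace g) = n - 1

/-- A transvection: a (necessarily nondiagonalizable) reflection of determinant one. -/
def IsTransvection (g : GLn F n) : Prop :=
  IsReflection g ∧ LinearMap.det g.toLinearMap = 1 ∧ g ≠ 1

/-- The pointwise stabilizer `G_H` of a subspace `H` in `G`. -/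
def pointStab (G : Subgroup (GLn F n)) (H : Submodule F (Fin n → F)) : Subgroup (GLn F n) where
  carrier := {g | g ∈ G ∧ ∀ v ∈ H, g v = v}
  one_mem' := ⟨G.one_mem, fun v _ => rfl⟩
  mul_mem' := fun {a b} ha hb => ⟨G.mul_mem ha.1 hb.1, fun v hv => by
    show a (b v) = v
    rw [hb.2 v hv, ha.2 v hv]⟩
  inv_mem' := fun {a} ha => ⟨G.inv_mem ha.1, fun v hv => by
    show a.symm v = v
    conv_lhs => rw [← ha.2 v hv]
    exact a.symm_apply_apply v⟩

/-- `K_H`: the subgroup of `G_H` of elements of determinant one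
(the transvections in `G_H` together with the identity). -/
noncomputable def KH (G : Subgroup (GLn F n)) (H : Submodule F (Fin n → F)) :
    Subgroup (GLn F n) :=
  pointStab G H ⊓ MonoidHom.ker LinearEquiv.det

/-- `e_H = |G_H : K_H|`. -/
noncomputable def eH (G : Subgroup (GLn F n)) (H : Submodule F (Fin n → F)) : ℕ :=
  ((KH G H).subgroupOf (pointStab G H)).index

/-- The transvection root space of `G_H`: the span of the root vectors of the
transvections in `G_H` (the root vector of `t` spans the range of `t - 1`). -/
noncomputable def trvSpace (G : Subgroup (GLn F n)) (H : Submodule F (Fin n → F)) :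
    Submodule F (Fin n → F) :=
  ⨆ g ∈ {g : GLn F n | g ∈ pointStab G H ∧ IsTransvection g},
    LinearMap.range (g.toLinearMap - LinearMap.id)

/-- `b_H`: the dimension of the transvection root space of `G_H`. -/
noncomputable def bH (G : Subgroup (GLn F n)) (H : Submodule F (Fin n → F)) : ℕ :=
  Module.finrank F (trvSpace G H)

theorem linToPoly_smul (c : F) (z : (Fin n → F) →ₗ[F] F) :
    linToPoly (c • z) = C c * linToPoly z := by
  simp [linToPoly, Finset.mul_sum, mul_assoc]

theorem linToPoly_sub (z w : (Fin n → F) →ₗ[F] F) :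
    linToPoly (z - w) = linToPoly z - linToPoly w := by
  simp [linToPoly, sub_mul]

theorem linToPoly_proj (i : Fin n) : linToPoly (LinearMap.proj i : (Fin n → F) →ₗ[F] F) = X i := by
  classical
  simp [linToPoly, Pi.single_apply, apply_ite C]

theorem eval_linToPoly (z : (Fin n → F) →ₗ[F] F) (x : Fin n → F) :
    eval x (linToPoly z) = z x := by
  classical
  simp only [linToPoly, map_sum, map_mul, eval_C, eval_X]
  rw [LinearMap.pi_apply_eq_sum_univ z x]
  refine Finset.sum_congr rfl fun i _ => ?_
  rw [smul_eq_mul, mul_comm]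
  congr 2
  ext j
  simp [Pi.single_apply, eq_comm]

theorem linToPoly_ne_zero {z : (Fin n → F) →ₗ[F] F} (hz : z ≠ 0) : linToPoly z ≠ 0 := by
  intro h
  exact hz (LinearMap.ext fun x => by rw [← eval_linToPoly, h, map_zero, LinearMap.zero_apply])

theorem irreducible_linToPoly {z : (Fin n → F) →ₗ[F] F} (hz : z ≠ 0) :
    Irreducible (linToPoly z) := by
  classical
  obtain ⟨j, hj⟩ : ∃ j, z (Pi.single j 1) ≠ 0 := by
    by_contra! h
    exact linToPoly_ne_zero hz (by simp [linToPoly, h])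
  have key : linToPoly z =
      sumSMulX (Finsupp.equivFunOnFinite.symm fun j => z (Pi.single j 1)) := by
    rw [sumSMulX, Finsupp.linearCombination_apply, Finsupp.sum_fintype _ _ (by simp)]
    simp [linToPoly, smul_eq_C_mul]
  rw [key]
  refine irreducible_sumSMulX _ ⟨j, by simpa using hj⟩ fun r hr => ?_
  refine isUnit_iff_ne_zero.mpr ?_
  rintro rfl
  exact hj (by simpa using hr j)

theorem isRelPrime_linToPoly {z w : (Fin n → F) →ₗ[F] F} (hz : z ≠ 0) (hw : w ≠ 0)
    (h : LinearMap.ker z ≠ LinearMap.ker w) : IsRelPrime (linToPoly z) (linToPoly w) := by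
  rw [(irreducible_linToPoly hz).isRelPrime_iff_not_dvd]
  intro hdvd
  apply h
  have hle : LinearMap.ker z ≤ LinearMap.ker w := by
    intro x hx
    obtain ⟨q, hq⟩ := hdvd
    have := congrArg (eval x) hq
    rw [map_mul, eval_linToPoly, eval_linToPoly, LinearMap.mem_ker.mp hx, zero_mul] at this
    exact this
  refine Submodule.eq_of_le_of_finrank_eq hle ?_
  have h1 := Module.Dual.finrank_ker_add_one_of_ne_zero (f := z) hz
  have h2 := Module.Dual.finrank_ker_add_one_of_ne_zero (f := w) hw
  omega

theorem polyAct_C (g : GLn F n) (c : F) : polyAct g (C c) = C c := (polyAct g).commutes c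

theorem actMat_mulVec (g : GLn F n) (y : Fin n → F) (i : Fin n) :
    ∑ j, y j * actMat g i j = g.symm y i := by
  classical
  conv_rhs => rw [pi_eq_sum_univ' y]
  simp [actMat, Finset.sum_apply]

theorem polyAct_linToPoly (g : GLn F n) (z : (Fin n → F) →ₗ[F] F) :
    polyAct g (linToPoly z) = linToPoly (z ∘ₗ g.symm.toLinearMap) := by
  have key : ∀ k, z (g.symm (Pi.single k 1)) = ∑ j, z (Pi.single j 1) * actMat g j k := by
    intro k
    conv_lhs => rw [pi_eq_sum_univ' (g.symm (Pi.single k 1)), map_sum]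
    exact Finset.sum_congr rfl fun j _ => by rw [map_smul, smul_eq_mul, mul_comm]; rfl
  simp only [linToPoly, LinearMap.comp_apply, LinearEquiv.coe_coe, key, map_sum, map_mul,
    polyAct, aeval_X, Finset.mul_sum, Finset.sum_mul]
  rw [Finset.sum_comm]
  refine Finset.sum_congr rfl fun k _ => Finset.sum_congr rfl fun j _ => ?_
  rw [show (aeval fun i => ∑ j, C (actMat g i j) * X j) (C (z (Pi.single j 1))) =
    C (z (Pi.single j 1)) from polyAct_C g _, mul_assoc]

/-- The contraction of a 1-form with a constant vector field. -/
noncomputable def contr (μ : Fin n → MvPolynomial (Fin n) F) :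
    (Fin n → F) →ₗ[F] MvPolynomial (Fin n) F :=
  Fintype.linearCombination F μ

theorem contr_apply (μ : Fin n → MvPolynomial (Fin n) F) (w : Fin n → F) :
    contr μ w = ∑ j, C (w j) * μ j := by
  simp [contr, Fintype.linearCombination_apply, smul_eq_C_mul]

theorem contr_oneFormAct (g : GLn F n) (μ : Fin n → MvPolynomial (Fin n) F) (w : Fin n → F) :
    contr (oneFormAct g μ) (g w) = polyAct g (contr μ w) := by
  simp only [contr_apply, oneFormAct, Finset.mul_sum, map_sum, map_mul, polyAct_C]
  rw [Finset.sum_comm]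
  refine Finset.sum_congr rfl fun i _ => ?_
  rw [← g.symm_apply_apply w, ← actMat_mulVec, map_sum, Finset.sum_mul]
  simp only [LinearEquiv.symm_apply_apply, map_mul]
  exact Finset.sum_congr rfl fun j _ => by ring

theorem polyAct_contr_of_invariant {g : GLn F n} {μ : Fin n → MvPolynomial (Fin n) F} {κ : F}
    (h : oneFormAct g μ = fun j => C κ * μ j) (w : Fin n → F) :
    polyAct g (contr μ w) = C κ * contr μ (g w) := by
  rw [← contr_oneFormAct, h]
  simp only [contr_apply, Finset.mul_sum]
  exact Finset.sum_congr rfl fun j _ => by ring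

theorem exists_eq_add_smul {l : (Fin n → F) →ₗ[F] F} (hl : l ≠ 0) {g : GLn F n}
    (hg : ∀ v ∈ LinearMap.ker l, g v = v) : ∃ α, ∀ x, g x = x + l x • α := by
  obtain ⟨v, hv⟩ := LinearMap.surjective hl 1
  refine ⟨g v - v, fun x => ?_⟩
  have := hg (x - l x • v) (by simp [hv])
  rw [map_sub, map_smul] at this
  rw [smul_sub, ← sub_eq_zero]
  rw [← sub_eq_zero] at this
  rw [← this]
  abel

section OneReflection

variable {l : (Fin n → F) →ₗ[F] F} {g : GLn F n} {α : Fin n → F}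

theorem det_of_eq_add_smul (hg : ∀ x, g x = x + l x • α) :
    LinearMap.det g.toLinearMap = 1 + l α := by
  have : g.toLinearMap = LinearMap.transvection l α := LinearMap.ext fun x => by
    simp [hg, LinearMap.transvection.apply]
  rw [this, LinearMap.transvection.det]

theorem apply_of_eq_add_smul (hg : ∀ x, g x = x + l x • α) (x : Fin n → F) :
    l (g x) = (1 + l α) * l x := by
  rw [hg, map_add, map_smul, smul_eq_mul]; ring

theorem one_add_ne_zero_of_eq_add_smul (hg : ∀ x, g x = x + l x • α) : 1 + l α ≠ 0 := by
  rw [← det_of_eq_add_smul hg]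
  exact (LinearEquiv.isUnit_det' g).ne_zero

theorem C_mul_polyAct_linToPoly (hg : ∀ x, g x = x + l x • α) :
    C (1 + l α) * polyAct g (linToPoly l) = linToPoly l := by
  rw [polyAct_linToPoly, ← linToPoly_smul]
  congr 1
  ext1 x
  ext
  simp only [LinearMap.comp_apply, LinearMap.smul_apply, smul_eq_mul, LinearEquiv.coe_coe]
  rw [← apply_of_eq_add_smul hg, LinearEquiv.apply_symm_apply]

theorem linToPoly_dvd_polyAct_sub (hg : ∀ x, g x = x + l x • α) (u : MvPolynomial (Fin n) F) :
    linToPoly l ∣ polyAct g u - u := by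
  have key : (Ideal.Quotient.mkₐ F (Ideal.span {linToPoly l})).comp (polyAct g) =
      Ideal.Quotient.mkₐ F (Ideal.span {linToPoly l}) := by
    refine MvPolynomial.algHom_ext fun i => ?_
    rw [AlgHom.comp_apply, Ideal.Quotient.mkₐ_eq_mk, Ideal.Quotient.eq,
      Ideal.mem_span_singleton, ← linToPoly_proj, polyAct_linToPoly, ← linToPoly_sub]
    refine ⟨C (-((1 + l α)⁻¹ * α i)), ?_⟩
    rw [mul_comm, ← linToPoly_smul]
    congr 1
    refine LinearMap.ext fun y => ?_
    obtain ⟨x, rfl⟩ := g.surjective y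
    have h0 := one_add_ne_zero_of_eq_add_smul hg
    simp only [LinearMap.sub_apply, LinearMap.comp_apply, LinearEquiv.coe_coe,
      LinearEquiv.symm_apply_apply, LinearMap.proj_apply, LinearMap.smul_apply,
      apply_of_eq_add_smul hg, smul_eq_mul]
    rw [hg x, Pi.add_apply, Pi.smul_apply, smul_eq_mul]
    field_simp
    ring
  have := DFunLike.congr_fun key u
  rwa [AlgHom.comp_apply, Ideal.Quotient.mkₐ_eq_mk, Ideal.Quotient.eq,
      Ideal.mem_span_singleton] at this

theorem linToPoly_mul_semiinvariant (hl : l ≠ 0) (hg : ∀ x, g x = x + l x • α) {κ : F}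
    {u : MvPolynomial (Fin n) F} (h : polyAct g (linToPoly l * u) = C κ * (linToPoly l * u)) :
    polyAct g u = C (κ * (1 + l α)) * u := by
  refine mul_left_cancel₀ (linToPoly_ne_zero hl) ?_
  nth_rw 1 [← C_mul_polyAct_linToPoly hg]
  rw [mul_assoc, ← map_mul, h, map_mul]
  ring

theorem pow_dvd_of_semiinvariant (hl : l ≠ 0) (hg : ∀ x, g x = x + l x • α) (m : ℕ) :
    ∀ (κ : F) (u : MvPolynomial (Fin n) F), polyAct g u = C κ * u →
      (∀ k < m, κ * (1 + l α) ^ k ≠ 1) → linToPoly l ^ m ∣ u := by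
  induction m with
  | zero => simp
  | succ m ih =>
    intro κ u hu hκ
    have h1 : κ - 1 ≠ 0 := sub_ne_zero.mpr (by simpa using hκ 0 (by omega))
    have h2 := linToPoly_dvd_polyAct_sub hg u
    rw [hu, show C κ * u - u = C (κ - 1) * u by rw [map_sub, map_one]; ring,
      (h1.isUnit.map C).dvd_mul_left] at h2
    obtain ⟨u, rfl⟩ := h2
    rw [pow_succ']
    refine mul_dvd_mul_left _ (ih _ _ (linToPoly_mul_semiinvariant hl hg hu) fun k hk => ?_)
    have := hκ (k + 1) (by omega)
    rwa [pow_succ', ← mul_assoc] at this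

theorem pow_orderOf_dvd_of_invariant (hl : l ≠ 0) (hg : ∀ x, g x = x + l x • α)
    {u : MvPolynomial (Fin n) F} (hu : polyAct g u = u) (hdvd : linToPoly l ∣ u) :
    linToPoly l ^ orderOf (1 + l α) ∣ u := by
  obtain h0 | h0 := Nat.eq_zero_or_pos (orderOf (1 + l α))
  · simp [h0]
  obtain ⟨u, rfl⟩ := hdvd
  rw [← Nat.succ_pred_eq_of_pos h0, pow_succ']
  refine mul_dvd_mul_left _ (pow_dvd_of_semiinvariant hl hg _ (1 + l α) u ?_ fun k hk => ?_)
  · simpa using linToPoly_mul_semiinvariant hl hg (κ := 1) (by simpa using hu)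
  · rw [← pow_succ']
    exact pow_ne_one_of_lt_orderOf (by omega) (by rw [Nat.pred_eq_sub_one] at hk; omega)

theorem pow_apply_of_eq_add_smul (hg : ∀ x, g x = x + l x • α) (hα : l α = 0) (k : ℕ)
    (x : Fin n → F) : (g ^ k) x = x + ((k : F) * l x) • α := by
  induction k with
  | zero => simp
  | succ k ih =>
    rw [pow_succ', LinearEquiv.mul_apply, ih, hg, map_add, map_smul, hα]
    push_cast
    module

theorem monoidHom_eq_one_of_transvection {G : Subgroup (GLn F n)} (χ : G →* Fˣ) {t : G}
    (hl : l ≠ 0)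
    (hg : ∀ x, (t : GLn F n) x = x + l x • α) (hα : l α = 0) (hα0 : α ≠ 0)
    (ht : IsOfFinOrder (t : GLn F n)) :
    χ t = 1 := by
  obtain ⟨v, hv⟩ := LinearMap.surjective hl 1
  obtain ⟨N, hN0, hN⟩ := isOfFinOrder_iff_pow_eq_one.mp ht
  have hNF : (N : F) = 0 := by
    have := pow_apply_of_eq_add_smul hg hα N v
    rw [hN, hv] at this
    simpa [hα0] using this
  obtain ⟨p, hp⟩ := CharP.exists F
  have hp0 : p ≠ 0 := by
    rintro rfl
    exact hN0.ne' (Nat.eq_zero_of_zero_dvd ((CharP.cast_eq_zero_iff F 0 N).mp hNF))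
  have : Fact p.Prime := ⟨(CharP.char_is_prime_or_zero F p).resolve_right hp0⟩
  have htp : t ^ p = 1 := by
    ext1
    refine LinearEquiv.ext fun x => ?_
    rw [Subgroup.coe_pow, pow_apply_of_eq_add_smul hg hα]
    simp
  have h1 : ((χ t : F) - 1) ^ p = 0 := by
    rw [sub_pow_char, ← Units.val_pow_eq_pow_val, ← map_pow, htp]
    simp
  exact Units.ext (sub_eq_zero.mp (pow_eq_zero_iff hp0 |>.mp h1))

end OneReflection

theorem pow_dvd_det_of_contr {l : (Fin n → F) →ₗ[F] F} {T : Submodule F (Fin n → F)}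
    (hT : T ≤ LinearMap.ker l) {v : Fin n → F} (hv : l v ≠ 0)
    (M : Fin n → Fin n → MvPolynomial (Fin n) F) (L : MvPolynomial (Fin n) F) {x y z : ℕ}
    (hMT : ∀ i, ∀ w ∈ T, L ^ x ∣ contr (M i) w)
    (hMl : ∀ i, ∀ w ∈ LinearMap.ker l, L ^ y ∣ contr (M i) w)
    (hMv : ∀ i, L ^ z ∣ contr (M i) v) :
    L ^ (z + (Module.finrank F T * x + (n - 1 - Module.finrank F T) * y)) ∣
      Matrix.det (Matrix.of M) := by
  classical
  obtain ⟨bT, hbT, -, hTs, hbTi⟩ := exists_linearIndepOn_id_extension (K := F)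
    (linearIndepOn_empty F (id : (Fin n → F) → _)) (Set.empty_subset (T : Set (Fin n → F)))
  obtain ⟨bH, hbH, hTH, hHs, hbHi⟩ := exists_linearIndepOn_id_extension (K := F)
    hbTi (hbT.trans (SetLike.coe_subset_coe.mpr hT))
  have hbTs : Submodule.span F bT = T := le_antisymm (Submodule.span_le.mpr hbT) hTs
  have hbHs : Submodule.span F bH = LinearMap.ker l := le_antisymm (Submodule.span_le.mpr hbH) hHs
  have hl : l ≠ 0 := by rintro rfl; exact hv rfl
  have hvs : v ∉ Submodule.span F bH := by rwa [hbHs, LinearMap.mem_ker]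
  have hvb : v ∉ bH := fun h => hvs (Submodule.subset_span h)
  have hSi := hbHi.id_insert hvs
  lift bH to Finset (Fin n → F) using hbHi.finite
  lift bT to Finset (Fin n → F) using hbTi.finite
  have hcT : bT.card = Module.finrank F T := by
    rw [← hbTs]; exact (finrank_span_finset_eq_card hbTi).symm
  have hcH : bH.card = Module.finrank F (LinearMap.ker l) := by
    rw [← hbHs]; exact (finrank_span_finset_eq_card hbHi).symm
  have hker : Module.finrank F (LinearMap.ker l) + 1 = n := by
    simpa using Module.Dual.finrank_ker_add_one_of_ne_zero (f := l) hl
  rw [Finset.mem_coe] at hvb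
  rw [← Finset.coe_insert] at hSi
  rw [Finset.coe_subset] at hTH
  have hcard : (insert v bH).card = n := by rw [Finset.card_insert_of_notMem hvb]; omega
  let e : Fin n ≃ (insert v bH : Finset _) := ((insert v bH).equivFinOfCardEq hcard).symm
  let d : (Fin n → F) → ℕ := fun w => if w = v then z else if w ∈ bT then x else y
  have hd : ∀ i, ∀ w ∈ insert v bH, L ^ d w ∣ contr (M i) w := by
    intro i w hw
    simp only [d]
    split_ifs with h1 h2
    · exact h1 ▸ hMv i
    · exact hMT i w (hbT h2)
    · exact hMl i w (hbH ((Finset.mem_insert.mp hw).resolve_left h1))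
  have hdsum : ∑ k, d (e k) = z + (Module.finrank F T * x + (n - 1 - Module.finrank F T) * y) := by
    rw [e.sum_comp (fun w => d w.1), Finset.sum_coe_sort (insert v bH) d,
      Finset.sum_insert hvb, ← Finset.sum_sdiff hTH]
    have h1 : ∑ w ∈ bT, d w = bT.card * x := by
      refine Finset.sum_const_nat fun w hw => ?_
      have : w ≠ v := by rintro rfl; exact hvb (hTH hw)
      simp [d, this, hw]
    have h2 : ∑ w ∈ bH \ bT, d w = (bH \ bT).card * y := by
      refine Finset.sum_const_nat fun w hw => ?_
      rw [Finset.mem_sdiff] at hw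
      have : w ≠ v := by rintro rfl; exact hvb hw.1
      simp [d, this, hw.2]
    rw [h1, h2, Finset.card_sdiff_of_subset hTH, hcT, hcH, show d v = z by simp [d],
      show Module.finrank F (LinearMap.ker l) = n - 1 by omega]
    ring
  choose q hq using fun i k => hd i (e k).1 (e k).2
  let P : Matrix (Fin n) (Fin n) F := Matrix.of fun k => (e k).1
  have hP : IsUnit P.det := by
    rw [← Matrix.isUnit_iff_isUnit_det, ← Matrix.linearIndependent_rows_iff_isUnit]
    exact LinearIndependent.comp (show LinearIndependent F (fun w : (insert v bH : Finset _) => w.1)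
      from hSi) e e.injective
  have hMP : Matrix.of M * (P.map C).transpose =
      Matrix.of fun i k => L ^ d (e k) * Matrix.of q i k := by
    ext1 i k
    simp only [Matrix.of_apply]
    rw [← hq, contr_apply, Matrix.mul_apply]
    exact Finset.sum_congr rfl fun j _ => by simp [P, mul_comm]
  have hdet := congrArg Matrix.det hMP
  rw [Matrix.det_mul, Matrix.det_transpose, Matrix.det_mul_row, Finset.prod_pow_eq_pow_sum,
    hdsum] at hdet
  have hPC : IsUnit (P.map C : Matrix _ _ (MvPolynomial (Fin n) F)).det := by
    have := hP.map (C : F →+* MvPolynomial (Fin n) F)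
    rwa [RingHom.map_det] at this
  exact (hPC.dvd_mul_right).mp (hdet ▸ Dvd.intro _ rfl)

theorem oneFormAct_sum_mul (g : GLn F n) (h : Fin n → MvPolynomial (Fin n) F)
    (ω : Fin n → Fin n → MvPolynomial (Fin n) F) :
    oneFormAct g (fun j => ∑ i, h i * ω i j) =
      fun j => ∑ i, polyAct g (h i) * oneFormAct g (ω i) j := by
  ext1 j
  simp only [oneFormAct, map_sum, map_mul, Finset.sum_mul, Finset.mul_sum]
  rw [Finset.sum_comm]
  exact Finset.sum_congr rfl fun i _ => Finset.sum_congr rfl fun k _ => by ring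

theorem existsUnique_coefficients_of_dvd_det (G : Subgroup (GLn F n)) (χ : G →* Fˣ)
    (ω : Fin n → Fin n → MvPolynomial (Fin n) F)
    (hω : ∀ i, ∀ g : G, oneFormAct (g : GLn F n) (ω i) = fun j => C (χ g : F) * ω i j)
    (hD : Matrix.det (Matrix.of ω) ≠ 0)
    (hdvd : ∀ ν : Fin n → Fin n → MvPolynomial (Fin n) F,
      (∀ i, ∀ g : G, oneFormAct (g : GLn F n) (ν i) = fun j => C (χ g : F) * ν i j) →
      Matrix.det (Matrix.of ω) ∣ Matrix.det (Matrix.of ν))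
    (μ : Fin n → MvPolynomial (Fin n) F)
    (hμ : ∀ g : G, oneFormAct (g : GLn F n) μ = fun j => C (χ g : F) * μ j) :
    ∃! h : Fin n → MvPolynomial (Fin n) F,
      (∀ i, h i ∈ invSub G) ∧ ∀ j, μ j = ∑ i, h i * ω i j := by
  classical
  have hinj : ∀ h h' : Fin n → MvPolynomial (Fin n) F,
      (∀ j, ∑ i, h i * ω i j = ∑ i, h' i * ω i j) → h = h' := by
    intro h h' hh
    refine sub_eq_zero.mp (Matrix.eq_zero_of_vecMul_eq_zero hD ?_)
    rw [Matrix.sub_vecMul, sub_eq_zero]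
    exact funext hh
  have hcramer : ∀ i, Matrix.det (Matrix.of ω) ∣ (Matrix.of ω).transpose.cramer μ i := by
    intro i
    rw [Matrix.cramer_transpose_apply]
    refine hdvd (Function.update ω i μ) fun k g => ?_
    by_cases hk : k = i
    · subst hk; simpa using hμ g
    · simpa [hk] using hω k g
  choose h hh using hcramer
  have hμh : ∀ j, μ j = ∑ i, h i * ω i j := by
    intro j
    refine mul_left_cancel₀ hD ?_
    have := congrFun (Matrix.mulVec_cramer (Matrix.of ω).transpose μ) j
    rw [Matrix.det_transpose, Pi.smul_apply, smul_eq_mul] at this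
    rw [← this, Matrix.mulVec, dotProduct, Finset.mul_sum]
    refine Finset.sum_congr rfl fun i _ => ?_
    rw [hh, Matrix.transpose_apply, Matrix.of_apply]
    ring
  refine ⟨h, ⟨fun i g hg => ?_, hμh⟩, fun h' hh' => hinj _ _ fun j => by rw [← hh'.2, hμh]⟩
  refine congrFun (hinj (fun i => polyAct g (h i)) h fun j => ?_) i
  have h1 := congrFun (hμ ⟨g, hg⟩) j
  rw [funext hμh, oneFormAct_sum_mul] at h1
  simp only [fun i => hω i ⟨g, hg⟩] at h1
  refine mul_left_cancel₀ (show C (χ ⟨g, hg⟩ : F) ≠ (0 : MvPolynomial (Fin n) F) by simp) ?_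
  rw [← h1, Finset.mul_sum]
  exact Finset.sum_congr rfl fun i _ => by ring

theorem pow_dvd_det_of_semiinvariant {G : Subgroup (GLn F n)}
    {H : Submodule F (Fin n → F)} {l : (Fin n → F) →ₗ[F] F} (hl : l ≠ 0)
    (hH : LinearMap.ker l = H) (χ : G →* Fˣ) {s : G} [Decidable (χ s = 1)]
    (hs : (s : GLn F n) ∈ pointStab G H) (hs1 : orderOf (s : GLn F n) = eH G H)
    (hs2 : orderOf (LinearMap.det (s : GLn F n).toLinearMap) = eH G H) {a a' : ℕ}
    (ha : ∀ m < a, (χ s : F) * LinearMap.det (s : GLn F n).toLinearMap ^ m ≠ 1)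
    (ha' : ∀ m < a', (χ s : F) * LinearMap.det (s : GLn F n).toLinearMap ^ (m + 1) ≠ 1)
    (ν : Fin n → Fin n → MvPolynomial (Fin n) F)
    (hν : ∀ i, ∀ g : G, oneFormAct (g : GLn F n) (ν i) = fun j => C (χ g : F) * ν i j) :
    linToPoly l ^ ((if χ s = 1 then eH G H * bH G H else 0) + (n - 1) * a + a') ∣
      Matrix.det (Matrix.of ν) := by
  classical
  subst hH
  obtain ⟨α, hα⟩ := exists_eq_add_smul hl hs.2
  have hdet := det_of_eq_add_smul hα
  simp only [hdet] at ha ha' hs2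
  have hcontr := fun i (g : G) w => polyAct_contr_of_invariant (hν i g) w
  have hT : trvSpace G (LinearMap.ker l) ≤ LinearMap.ker l := by
    refine iSup₂_le fun t ht => ?_
    obtain ⟨β, hβ⟩ := exists_eq_add_smul hl ht.1.2
    have h1 : l β = 0 := by
      have := (det_of_eq_add_smul hβ).symm.trans ht.2.2.1
      simpa using this
    rintro _ ⟨w, rfl⟩
    simp [hβ, h1]
  obtain ⟨v, hv, hsv⟩ : ∃ v, l v ≠ 0 ∧ (s : GLn F n) v = (1 + l α) • v := by
    by_cases h0 : l α = 0
    · obtain ⟨v, hv⟩ := LinearMap.surjective hl 1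
      refine ⟨v, by simp [hv], ?_⟩
      have h1 : (s : GLn F n) = 1 := by
        rw [← orderOf_eq_one_iff, hs1, ← hs2, h0, add_zero, orderOf_one]
      simp [h1, h0]
    · exact ⟨α, h0, by rw [hα, add_smul, one_smul]⟩
  have hker : ∀ i, ∀ w ∈ LinearMap.ker l, linToPoly l ^ a ∣ contr (ν i) w := by
    intro i w hw
    refine pow_dvd_of_semiinvariant hl hα a (χ s : F) _ ?_ ha
    rw [hcontr, hs.2 w hw]
  have hnorm : ∀ i, linToPoly l ^ a' ∣ contr (ν i) v := by
    intro i
    refine pow_dvd_of_semiinvariant hl hα a' ((χ s : F) * (1 + l α)) _ ?_ fun k hk => ?_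
    · rw [hcontr, hsv, map_smul, smul_eq_C_mul, map_mul, mul_assoc]
    · rw [mul_assoc, ← pow_succ']; exact ha' k hk
  have hle : bH G (LinearMap.ker l) ≤ n - 1 := by
    have h1 := Submodule.finrank_mono hT
    have h2 := Module.Dual.finrank_ker_add_one_of_ne_zero (f := l) hl
    simp only [Module.finrank_fin_fun] at h2
    unfold bH
    omega
  by_cases hχ : χ s = 1
  · obtain rfl : a = 0 := by
      by_contra h
      exact ha 0 (by omega) (by simp [hχ])
    have hroot : ∀ i, ∀ w ∈ trvSpace G (LinearMap.ker l),
        linToPoly l ^ eH G (LinearMap.ker l) ∣ contr (ν i) w := by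
      intro i w hw
      suffices h : trvSpace G (LinearMap.ker l) ≤ ((Ideal.span
          {linToPoly l ^ eH G (LinearMap.ker l)}).restrictScalars F).comap (contr (ν i)) by
        simpa [Ideal.mem_span_singleton] using h hw
      refine iSup₂_le fun t ht => ?_
      obtain ⟨β, hβ⟩ := exists_eq_add_smul hl ht.1.2
      have h1 : l β = 0 := by
        have := (det_of_eq_add_smul hβ).symm.trans ht.2.2.1
        simpa using this
      have hβ0 : β ≠ 0 := by
        rintro rfl
        exact ht.2.2.2 (LinearEquiv.ext fun x => by simp [hβ])
      have hχt : χ ⟨t, ht.1.1⟩ = 1 :=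
        monoidHom_eq_one_of_transvection χ hl hβ h1 hβ0 ht.2.1.1
      rintro _ ⟨w, rfl⟩
      have hw : (t.toLinearMap - LinearMap.id : (Fin n → F) →ₗ[F] (Fin n → F)) w = l w • β := by simp [hβ]
      rw [hw]
      refine Submodule.smul_mem _ _ ?_
      simp only [Submodule.mem_comap, Submodule.restrictScalars_mem, Ideal.mem_span_singleton]
      rw [← hs2]
      refine pow_orderOf_dvd_of_invariant hl hα ?_ ?_
      · rw [hcontr, hχ, hs.2 β h1]; simp
      · obtain ⟨u, hu⟩ := LinearMap.surjective hl 1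
        have h2 := hcontr i ⟨t, ht.1.1⟩ u
        rw [hχt, hβ, hu, one_smul, map_add] at h2
        have h3 := linToPoly_dvd_polyAct_sub hβ (contr (ν i) u)
        rw [h2] at h3
        simpa using h3
    refine (pow_dvd_pow _ ?_).trans (pow_dvd_det_of_contr hT hv ν _ hroot hker hnorm)
    rw [if_pos hχ, show Module.finrank F (trvSpace G (LinearMap.ker l)) = bH G _ from rfl]
    apply le_of_eq
    ring
  · refine (pow_dvd_pow _ ?_).trans (pow_dvd_det_of_contr hT hv ν _
      (fun i w hw => hker i w (hT hw)) hker hnorm)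
    rw [if_neg hχ, show Module.finrank F (trvSpace G (LinearMap.ker l)) = bH G _ from rfl,
      ← add_mul, Nat.add_sub_cancel' hle]
    omega

/-- χ-analogue of the freeness criterion. If χ-invariant 1-forms
`ω₁,…,ωₙ` satisfy `ω₁ ∧ ⋯ ∧ ωₙ ≐ Q(Ã_χ)·Q_χ^{n-1}·Q_{χ·det}·vol`, then they are a
basis of `(Ω¹)^G_χ` as a free `F[V]^G`-module. -/
theorem stmt17 {F : Type*} [Field F] (h2 : ringChar F ≠ 2) {n : ℕ}
    (G : Subgroup (GLn F n)) [Finite G]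
    (hrefl : Subgroup.closure {g : GLn F n | g ∈ G ∧ IsReflection g} = G)
    (A : Finset (Submodule F (Fin n → F)))
    (hA : ∀ H, H ∈ A ↔ ∃ g ∈ G, IsReflection g ∧ fixedSpace g = H)
    (ℓ : Submodule F (Fin n → F) → ((Fin n → F) →ₗ[F] F))
    (hℓ : ∀ H ∈ A, ℓ H ≠ 0 ∧ LinearMap.ker (ℓ H) = H)
    (χ : G →* Fˣ)
    (sH : Submodule F (Fin n → F) → G)
    (hsH : ∀ H ∈ A, (sH H : GLn F n) ∈ pointStab G H ∧
      orderOf (sH H : GLn F n) = eH G H ∧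
      orderOf (LinearMap.det (sH H : GLn F n).toLinearMap) = eH G H ∧
      ((sH H : GLn F n) = 1 ∨ IsReflection (sH H : GLn F n)))
    (a a' : Submodule F (Fin n → F) → ℕ)
    (ha : ∀ H ∈ A,
      (χ (sH H) : F) * LinearMap.det (sH H : GLn F n).toLinearMap ^ a H = 1 ∧
      ∀ m < a H, (χ (sH H) : F) * LinearMap.det (sH H : GLn F n).toLinearMap ^ m ≠ 1)
    (ha' : ∀ H ∈ A,
      (χ (sH H) : F) * LinearMap.det (sH H : GLn F n).toLinearMap ^ (a' H + 1) = 1 ∧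
      ∀ m < a' H, (χ (sH H) : F) * LinearMap.det (sH H : GLn F n).toLinearMap ^ (m + 1) ≠ 1)
    (Aχ : Finset (Submodule F (Fin n → F)))
    (hAχ : ∀ H, H ∈ Aχ ↔ H ∈ A ∧ χ (sH H) = 1)
    (ω : Fin n → Fin n → MvPolynomial (Fin n) F)
    (hω : ∀ i, ∀ g : G, oneFormAct (g : GLn F n) (ω i) = fun j => C (χ g : F) * ω i j)
    (c : F) (hc : c ≠ 0)
    (hdet : Matrix.det (Matrix.of fun i j => ω i j) =
      C c * ((∏ H ∈ Aχ, linToPoly (ℓ H) ^ (eH G H * bH G H)) *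
        (∏ H ∈ A, linToPoly (ℓ H) ^ a H) ^ (n - 1) *
        ∏ H ∈ A, linToPoly (ℓ H) ^ a' H)) :
    ∀ μ : Fin n → MvPolynomial (Fin n) F,
      (∀ g : G, oneFormAct (g : GLn F n) μ = fun j => C (χ g : F) * μ j) →
      ∃! h : Fin n → MvPolynomial (Fin n) F,
        (∀ i, h i ∈ invSub G) ∧ ∀ j, μ j = ∑ i, h i * ω i j := by
  classical
  set D := Matrix.det (Matrix.of fun i j => ω i j) with hD
  have hdvd : ∀ ν : Fin n → Fin n → MvPolynomial (Fin n) F,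
      (∀ i, ∀ g : G, oneFormAct (g : GLn F n) (ν i) = fun j => C (χ g : F) * ν i j) →
      D ∣ Matrix.det (Matrix.of ν) := by
    intro ν hν
    have hprod : (∏ H ∈ Aχ, linToPoly (ℓ H) ^ (eH G H * bH G H)) *
        (∏ H ∈ A, linToPoly (ℓ H) ^ a H) ^ (n - 1) * ∏ H ∈ A, linToPoly (ℓ H) ^ a' H =
        ∏ H ∈ A, linToPoly (ℓ H) ^
          ((if χ (sH H) = 1 then eH G H * bH G H else 0) + (n - 1) * a H + a' H) := by
      have hAχ' : Aχ = A.filter fun H => χ (sH H) = 1 := by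
        ext H; simp [hAχ]
      rw [hAχ', Finset.prod_filter, ← Finset.prod_pow, ← Finset.prod_mul_distrib,
        ← Finset.prod_mul_distrib]
      refine Finset.prod_congr rfl fun H _ => ?_
      rw [pow_add, pow_add, mul_comm (n - 1), pow_mul _ (a H)]
      split_ifs <;> simp
    rw [hdet, (hc.isUnit.map C).mul_left_dvd, hprod]
    refine Finset.prod_dvd_of_isRelPrime ?_ ?_
    · intro H hH H' hH' hne
      refine (isRelPrime_linToPoly (hℓ H hH).1 (hℓ H' hH').1 ?_).pow
      rwa [(hℓ H hH).2, (hℓ H' hH').2]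
    · intro H hH
      obtain ⟨h1, h2, h3, -⟩ := hsH H hH
      exact pow_dvd_det_of_semiinvariant (hℓ H hH).1 (hℓ H hH).2 χ h1 h2 h3
        (ha H hH).2 (ha' H hH).2 ν hν
  have hD0 : D ≠ 0 := by
    rw [hdet]
    have hne : ∀ H ∈ A, linToPoly (ℓ H) ≠ 0 := fun H hH => linToPoly_ne_zero (hℓ H hH).1
    refine mul_ne_zero (by simpa using hc) (mul_ne_zero (mul_ne_zero ?_ (pow_ne_zero _ ?_)) ?_)
    · exact Finset.prod_ne_zero_iff.mpr fun H hH => pow_ne_zero _ (hne H ((hAχ H).mp hH).1)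
    · exact Finset.prod_ne_zero_iff.mpr fun H hH => pow_ne_zero _ (hne H hH)
    · exact Finset.prod_ne_zero_iff.mpr fun H hH => pow_ne_zero _ (hne H hH)
  exact existsUnique_coefficients_of_dvd_det G χ ω hω hD0 hdvd
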